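/- Let K be an algebraically closed field of characteristic zero, k ≥ 1, and let H ∈ K[y,z] be a linear combination of at most two (2k+2)-nd powers of pairwise linearly independent linear forms in y and z. Set Fα := x·y^{k-1}·z^{k+2} + y^{2k}·z² − H ∈ K[x,y,z]. Then for every integer n with 0 ≤ n ≤ k, the K-dimension of the span of all n-th order partial derivatives of Fα equals 2n+1. -/

import Mathlib

open MvPolynomial

/-- The span of all `n`-th order partial derivatives of a ternary polynomial `F`
(with variables `x = X 0`, `y = X 1`, `z = X 2`). -/
noncomputable def derivSpan (K : Type*) [CommSemiring K] (n : ℕ)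
    (F : MvPolynomial (Fin 3) K) : Submodule K (MvPolynomial (Fin 3) K) :=
  Submodule.span K {G | ∃ i j l : ℕ, i + j + l = n ∧
    G = (⇑(pderiv (0 : Fin 3)))^[i] ((⇑(pderiv (1 : Fin 3)))^[j]
          ((⇑(pderiv (2 : Fin 3)))^[l] F))}

/-- The exponent vector of the monomial `x ^ p * y ^ q * z ^ r`. -/
noncomputable def expVec (p q r : ℕ) : Fin 3 →₀ ℕ :=
  Finsupp.equivFunOnFinite.symm ![p, q, r]

@[simp] lemma expVec_zero (p q r : ℕ) : expVec p q r 0 = p := rfl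

@[simp] lemma expVec_one (p q r : ℕ) : expVec p q r 1 = q := rfl

@[simp] lemma expVec_two (p q r : ℕ) : expVec p q r 2 = r := rfl

lemma expVec_inj {p q r p' q' r' : ℕ} :
    expVec p q r = expVec p' q' r' ↔ p = p' ∧ q = q' ∧ r = r' := by
  simp [Finsupp.ext_iff, Fin.forall_fin_succ]

lemma eq_expVec (m : Fin 3 →₀ ℕ) : m = expVec (m 0) (m 1) (m 2) := by
  ext i
  fin_cases i <;> rfl

lemma monomial_expVec {R : Type*} [CommSemiring R] (p q r : ℕ) :
    monomial (expVec p q r) (1 : R) = X 0 ^ p * X 1 ^ q * X 2 ^ r := by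
  rw [monomial_eq, Finsupp.prod_fintype _ _ (by simp)]
  simp [Fin.prod_univ_three]

lemma coeff_monomial_expVec {R : Type*} [CommSemiring R] (p q r p' q' r' : ℕ) :
    coeff (expVec p q r) (monomial (expVec p' q' r') (1 : R)) =
      if p' = p ∧ q' = q ∧ r' = r then 1 else 0 := by
  simp only [coeff_monomial, expVec_inj]

lemma coeff_iterate_pderiv {σ R : Type*} [CommSemiring R] (i : σ) (r : ℕ) (m : σ →₀ ℕ)
    (F : MvPolynomial σ R) :
    coeff m ((⇑(pderiv i))^[r] F) =
      coeff (m + Finsupp.single i r) F * ((m i + 1).ascFactorial r : ℕ) := by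
  induction r generalizing F with
  | zero => simp
  | succ r ih =>
    rw [Function.iterate_succ_apply, ih, coeff_pderiv, add_assoc, ← Finsupp.single_add,
      Nat.ascFactorial_succ]
    simp only [Finsupp.add_apply, Finsupp.single_eq_same]
    push_cast
    ring

section

variable {K : Type*} [Field K]

/-- The partial derivative of order `(i, j, l)` of a ternary polynomial. -/
noncomputable def mixedDeriv (i j l : ℕ) (F : MvPolynomial (Fin 3) K) :
    MvPolynomial (Fin 3) K :=
  (⇑(pderiv (0 : Fin 3)))^[i] ((⇑(pderiv (1 : Fin 3)))^[j] ((⇑(pderiv (2 : Fin 3)))^[l] F))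

lemma coeff_mixedDeriv (i j l p q r : ℕ) (F : MvPolynomial (Fin 3) K) :
    coeff (expVec p q r) (mixedDeriv i j l F) =
      ((p + 1).ascFactorial i * (q + 1).ascFactorial j * (r + 1).ascFactorial l : ℕ) *
        coeff (expVec (p + i) (q + j) (r + l)) F := by
  have h : expVec p q r + Finsupp.single 0 i + Finsupp.single 1 j + Finsupp.single 2 l =
      expVec (p + i) (q + j) (r + l) := by
    ext s
    fin_cases s <;> simp
  simp only [mixedDeriv, coeff_iterate_pderiv, h]
  simp
  ring

lemma coeff_mixedDeriv_eq_zero_iff [CharZero K] (i j l p q r : ℕ) (F : MvPolynomial (Fin 3) K) :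
    coeff (expVec p q r) (mixedDeriv i j l F) = 0 ↔
      coeff (expVec (p + i) (q + j) (r + l)) F = 0 := by
  rw [coeff_mixedDeriv, mul_eq_zero, or_iff_right]
  exact_mod_cast (by positivity)

/-- If `F` has degree at most one in `x`, its derivatives of order at least two in `x` vanish. -/
lemma mixedDeriv_eq_zero {F : MvPolynomial (Fin 3) K}
    (h : ∀ p q r, 2 ≤ p → coeff (expVec p q r) F = 0) {i : ℕ} (hi : 2 ≤ i) (j l : ℕ) :
    mixedDeriv i j l F = 0 := by
  ext m
  rw [eq_expVec m, coeff_mixedDeriv, h _ _ _ (by omega)]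
  simp

/-- The derivatives of order `n` of `F` which are of order at most one in `x`. -/
noncomputable def derivFamily (n : ℕ) (F : MvPolynomial (Fin 3) K) :
    Fin n ⊕ Fin (n + 1) → MvPolynomial (Fin 3) K :=
  Sum.elim (fun j => mixedDeriv 1 j (n - 1 - j) F) (fun j => mixedDeriv 0 j (n - j) F)

lemma derivSpan_eq_span_range {F : MvPolynomial (Fin 3) K}
    (h : ∀ p q r, 2 ≤ p → coeff (expVec p q r) F = 0) (n : ℕ) :
    derivSpan K n F = Submodule.span K (Set.range (derivFamily n F)) := by
  apply le_antisymm
  · refine Submodule.span_le.2 ?_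
    rintro G ⟨i, j, l, hn, rfl⟩
    change mixedDeriv i j l F ∈ _
    rcases i with _ | _ | i
    · refine Submodule.subset_span ⟨Sum.inr ⟨j, by omega⟩, ?_⟩
      simp [derivFamily, show n - j = l by omega]
    · refine Submodule.subset_span ⟨Sum.inl ⟨j, by omega⟩, ?_⟩
      simp [derivFamily, show n - 1 - j = l by omega]
    · rw [mixedDeriv_eq_zero h (by omega)]
      exact zero_mem _
  · refine Submodule.span_mono ?_
    rintro _ ⟨j | j, rfl⟩
    · exact ⟨1, j, n - 1 - j, by omega, rfl⟩
    · exact ⟨0, j, n - j, by omega, rfl⟩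

/-- The derivatives of order `n ≤ k` of `F = x * y ^ (k - 1) * z ^ (k + 2) + G(y, z)` which are of
order at most one in `x` are linearly independent as soon as some monomial of `G` is divisible by
`y ^ (2k)`. -/
lemma linearIndependent_derivFamily [CharZero K] {k : ℕ} (hk : 1 ≤ k)
    {F : MvPolynomial (Fin 3) K}
    (htwo : ∀ p q r, 2 ≤ p → coeff (expVec p q r) F = 0)
    (hone : ∀ q r, coeff (expVec 1 q r) F ≠ 0 ↔ q = k - 1 ∧ r = k + 2)
    (hzero : ∃ q r, coeff (expVec 0 (2 * k + q) r) F ≠ 0)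
    {n : ℕ} (hn : n ≤ k) : LinearIndependent K (derivFamily n F) := by
  have hone' : ∀ q r, ¬ (q = k - 1 ∧ r = k + 2) → coeff (expVec 1 q r) F = 0 := fun q r h => by
    by_contra h'
    exact h ((hone q r).1 h')
  rw [Fintype.linearIndependent_iff]
  intro g hg
  have key (p q r : ℕ) : ∑ j : Fin n,
      g (Sum.inl j) * coeff (expVec p q r) (mixedDeriv 1 j (n - 1 - j) F) +
      ∑ j : Fin (n + 1), g (Sum.inr j) * coeff (expVec p q r) (mixedDeriv 0 j (n - j) F) = 0 := by
    simpa [Fintype.sum_sum_type, derivFamily, coeff_sum] using congrArg (coeff (expVec p q r)) hg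
  have hlow (j : Fin (n + 1)) (hj : (j : ℕ) < k) : g (Sum.inr j) = 0 := by
    have h := key 1 (k - 1 - j) (k + 2 - (n - j))
    rw [Finset.sum_eq_zero, Finset.sum_eq_single j, zero_add] at h
    · refine (mul_eq_zero.1 h).resolve_right ?_
      rw [coeff_mixedDeriv_eq_zero_iff]
      exact (hone _ _).2 (by omega)
    · intro s _ hs
      rw [(coeff_mixedDeriv_eq_zero_iff _ _ _ _ _ _ _).2, mul_zero]
      exact hone' _ _ (by have := Fin.val_ne_of_ne hs; omega)
    · simp
    · intro s _
      rw [(coeff_mixedDeriv_eq_zero_iff _ _ _ _ _ _ _).2, mul_zero]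
      exact htwo _ _ _ (by omega)
  have hright (j : Fin (n + 1)) : g (Sum.inr j) = 0 := by
    by_cases hj : (j : ℕ) < k
    · exact hlow j hj
    obtain ⟨q, r, hqr⟩ := hzero
    have h := key 0 (k + q) r
    rw [Finset.sum_eq_zero, Finset.sum_eq_single j, zero_add] at h
    · refine (mul_eq_zero.1 h).resolve_right ?_
      rw [coeff_mixedDeriv_eq_zero_iff]
      rwa [add_zero, show k + q + (j : ℕ) = 2 * k + q by omega, show n - (j : ℕ) = 0 by omega,
        add_zero]
    · intro s _ hs
      rw [hlow s (by have := Fin.val_ne_of_ne hs; omega), zero_mul]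
    · simp
    · intro s _
      rw [(coeff_mixedDeriv_eq_zero_iff _ _ _ _ _ _ _).2, mul_zero]
      exact hone' _ _ (by omega)
  rintro (j | j)
  · have h := key 0 (k - 1 - j) (k + 2 - (n - 1 - j))
    rw [Finset.sum_eq_single j, Finset.sum_eq_zero, add_zero] at h
    · refine (mul_eq_zero.1 h).resolve_right ?_
      rw [coeff_mixedDeriv_eq_zero_iff]
      exact (hone _ _).2 (by omega)
    · intro s _
      rw [hright, zero_mul]
    · intro s _ hs
      rw [(coeff_mixedDeriv_eq_zero_iff _ _ _ _ _ _ _).2, mul_zero]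
      exact hone' _ _ (by have := Fin.val_ne_of_ne hs; omega)
    · simp
  · exact hright j

lemma coeff_eq_zero_of_pderiv_eq_zero [CharZero K] {F : MvPolynomial (Fin 3) K}
    (h : pderiv 0 F = 0) {p : ℕ} (hp : p ≠ 0) (q r : ℕ) : coeff (expVec p q r) F = 0 := by
  obtain ⟨p, rfl⟩ := Nat.exists_eq_succ_of_ne_zero hp
  exact (coeff_mixedDeriv_eq_zero_iff 1 0 0 p q r F).1 (by simp [mixedDeriv, h])

/-- A linear form not involving `x` is a combination of `y` and `z`. -/
lemma exists_eq_sum_smul_X [CharZero K] {f : MvPolynomial (Fin 3) K} (hf : f.IsHomogeneous 1)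
    (h : pderiv 0 f = 0) : ∃ a b : K, f = ∑ i, (![0, a, b] : Fin 3 → K) i • X i := by
  rw [← mem_homogeneousSubmodule, homogeneousSubmodule_one_eq_span_X,
    Submodule.mem_span_range_iff_exists_fun] at hf
  obtain ⟨c, rfl⟩ := hf
  have hc : c 0 = 0 := by
    simpa [Fin.sum_univ_three, pderiv_X, Pi.single_apply, smul_eq_C_mul] using h
  exact ⟨c 1, c 2, by simp [Fin.sum_univ_three, hc]⟩

lemma coeff_sum_smul_X_pow (a b : K) (q r : ℕ) :
    coeff (expVec 0 q r) ((∑ i, (![0, a, b] : Fin 3 → K) i • X i) ^ (q + r)) =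
      (expVec 0 q r).multinomial * (a ^ q * b ^ r) := by
  rw [coeff_linearCombination_X_pow_of_fintype, Finsupp.sum_fintype _ _ (by simp),
    Finsupp.prod_fintype _ _ (by simp), if_pos (by simp [Fin.sum_univ_three])]
  simp [Fin.prod_univ_three]

/-- Two linearly independent binary forms `a 0 * y + b 0 * z`, `a 1 * y + b 1 * z` have nonzero
determinant. -/
lemma det_ne_zero_of_linearIndependent {a b : Fin 2 → K}
    (h : LinearIndependent K fun s =>
      (∑ i, (![0, a s, b s] : Fin 3 → K) i • X i : MvPolynomial (Fin 3) K)) :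
    a 0 * b 1 - a 1 * b 0 ≠ 0 := by
  intro hdet
  have hdetC : (C (a 0) * C (b 1) - C (a 1) * C (b 0) : MvPolynomial (Fin 3) K) = 0 := by
    rw [← C_mul, ← C_mul, ← C_sub, hdet, C_0]
  have hrel := Fintype.linearIndependent_iff.1 h
  have hb := hrel ![b 1, -b 0] (by
    simp only [Fin.sum_univ_three, Fin.sum_univ_two, smul_eq_C_mul]
    simp
    linear_combination (X 1 : MvPolynomial (Fin 3) K) * hdetC)
  have ha := hrel ![a 1, -a 0] (by
    simp only [Fin.sum_univ_three, Fin.sum_univ_two, smul_eq_C_mul]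
    simp
    linear_combination -(X 2 : MvPolynomial (Fin 3) K) * hdetC)
  refine h.ne_zero 0 ?_
  have hb0 := hb 1
  have ha0 := ha 1
  simp at hb0 ha0
  simp [Fin.sum_univ_three, ha0, hb0]

/-- If a combination of two `(d + 2)`-nd powers of independent binary linear forms has vanishing
coefficients at `y ^ (d + 2)` and `y ^ (d + 1) * z`, it also has vanishing coefficient at
`y ^ d * z ^ 2`. -/
lemma sum_mul_pow_mul_sq_eq_zero {a₀ a₁ b₀ b₁ c₀ c₁ : K} (hdet : a₀ * b₁ - a₁ * b₀ ≠ 0) {d : ℕ}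
    (hd : d ≠ 0) (h₀ : c₀ * a₀ ^ (d + 2) + c₁ * a₁ ^ (d + 2) = 0)
    (h₁ : c₀ * (a₀ ^ (d + 1) * b₀) + c₁ * (a₁ ^ (d + 1) * b₁) = 0) :
    c₀ * (a₀ ^ d * b₀ ^ 2) + c₁ * (a₁ ^ d * b₁ ^ 2) = 0 := by
  have e₀ : c₀ * a₀ ^ (d + 1) = 0 := by
    refine (mul_eq_zero.1 (?_ : (c₀ * a₀ ^ (d + 1)) * (a₀ * b₁ - a₁ * b₀) = 0)).resolve_right hdet
    linear_combination b₁ * h₀ - a₁ * h₁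
  have e₁ : c₁ * a₁ ^ (d + 1) = 0 := by
    refine (mul_eq_zero.1 (?_ : (c₁ * a₁ ^ (d + 1)) * (a₀ * b₁ - a₁ * b₀) = 0)).resolve_right hdet
    linear_combination a₀ * h₁ - b₀ * h₀
  have f₀ : c₀ * a₀ ^ d = 0 := by simpa [hd] using e₀
  have f₁ : c₁ * a₁ ^ d = 0 := by simpa [hd] using e₁
  linear_combination b₀ ^ 2 * f₀ + b₁ ^ 2 * f₁

end

/-- If `H` is a linear combination of at most two `(2k+2)`-nd powers of pairwise
linearly independent linear forms in `y, z` and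
`Fα = x·y^{k-1}·z^{k+2} + y^{2k}·z² − H`, then for `0 ≤ n ≤ k` the span of the
`n`-th order partial derivatives of `Fα` has dimension `2n + 1`. -/
theorem hilbert_function_Falpha_low (K : Type*) [Field K] [IsAlgClosed K] [CharZero K]
    (k : ℕ) (hk : 1 ≤ k)
    (c : Fin 2 → K) (ℓ : Fin 2 → MvPolynomial (Fin 3) K)
    (hhom : ∀ i, (ℓ i).IsHomogeneous 1)
    (hyz : ∀ i, pderiv 0 (ℓ i) = 0)
    (hind : LinearIndependent K ℓ)
    (H : MvPolynomial (Fin 3) K)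
    (hH : H = c 0 • ℓ 0 ^ (2 * k + 2) + c 1 • ℓ 1 ^ (2 * k + 2))
    (n : ℕ) (hn : n ≤ k) :
    Module.finrank K
        (derivSpan K n
          (X 0 * X 1 ^ (k - 1) * X 2 ^ (k + 2) + X 1 ^ (2 * k) * X 2 ^ 2 - H)) =
      2 * n + 1 := by
  have hH0 : pderiv 0 H = 0 := by simp [hH, hyz]
  have hF : (X 0 * X 1 ^ (k - 1) * X 2 ^ (k + 2) + X 1 ^ (2 * k) * X 2 ^ 2 - H :
      MvPolynomial (Fin 3) K) =
      monomial (expVec 1 (k - 1) (k + 2)) 1 + monomial (expVec 0 (2 * k) 2) 1 - H := by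
    simp [monomial_expVec]
  rw [hF]
  have htwo (p q r : ℕ) (hp : 2 ≤ p) : coeff (expVec p q r)
      (monomial (expVec 1 (k - 1) (k + 2)) 1 + monomial (expVec 0 (2 * k) 2) 1 - H) = 0 := by
    rw [coeff_sub, coeff_add, coeff_monomial_expVec, coeff_monomial_expVec,
      coeff_eq_zero_of_pderiv_eq_zero hH0 (by omega), if_neg (by omega), if_neg (by omega)]
    simp
  rw [derivSpan_eq_span_range htwo, finrank_span_eq_card, Fintype.card_sum, Fintype.card_fin,
    Fintype.card_fin]
  · ring
  refine linearIndependent_derivFamily hk htwo (fun q r => ?_) ?_ hn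
  · rw [coeff_sub, coeff_add, coeff_monomial_expVec, coeff_monomial_expVec,
      coeff_eq_zero_of_pderiv_eq_zero hH0 one_ne_zero]
    simp [eq_comm]
  · choose a b hab using fun i => exists_eq_sum_smul_X (hhom i) (hyz i)
    obtain rfl : ℓ = fun s => ∑ i, (![0, a s, b s] : Fin 3 → K) i • X i := funext hab
    have hcoeff (q r : ℕ) (hqr : q + r = 2 * k + 2) : coeff (expVec 0 q r) H =
        (expVec 0 q r).multinomial * (c 0 * (a 0 ^ q * b 0 ^ r) + c 1 * (a 1 ^ q * b 1 ^ r)) := by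
      rw [hH, coeff_add, coeff_smul, coeff_smul, ← hqr, coeff_sum_smul_X_pow,
        coeff_sum_smul_X_pow]
      simp only [smul_eq_mul]
      ring
    have hmult (q r : ℕ) : ((expVec 0 q r).multinomial : K) ≠ 0 :=
      Nat.cast_ne_zero.2 (Nat.multinomial_pos _ _).ne'
    by_contra! hall
    have h₀ := hall 2 0
    have h₁ := hall 1 1
    have h₂ := hall 0 2
    rw [coeff_sub, coeff_add, coeff_monomial_expVec, coeff_monomial_expVec,
      hcoeff _ _ (by omega)] at h₀ h₁ h₂
    simp [hmult] at h₀ h₁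
    rw [add_zero, sum_mul_pow_mul_sq_eq_zero (det_ne_zero_of_linearIndependent hind)
      (by omega) h₀ h₁] at h₂
    simp at h₂
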